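/- arXiv:1002.4105 — 3 statements merged into one kernel-verified Lean document; each statement's English description precedes it below -/
import Mathlib

section
/- Let vol be an affine volume on an n-dimensional real affine space 𝔸ₙ. Then the quantity vol(p, p + v₁, …, p + vₙ) does not depend on the choice of the point p, and the resulting function mlt : (Vₙ)ⁿ → ℝ defined by mlt(v₁, …, vₙ) := vol(p, p + v₁, …, p + vₙ) is multilinear and alternating. -/
open Function Equiv

section AffineVolume

variable {ι V P : Type*} [DecidableEq ι] [AddCommGroup V] [AddTorsor V P]

/-- A function that changes sign under transpositions vanishes on families with a repetition. -/
theorem eq_zero_of_swap_neg {X : Type*} {vol : (ι → X) → ℝ}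
    (h : ∀ i j, i ≠ j → ∀ ps, vol (ps ∘ swap i j) = -vol ps)
    {ps : ι → X} {i j : ι} (hij : i ≠ j) (heq : ps i = ps j) : vol ps = 0 := by
  have hps : ps ∘ swap i j = ps := by
    rw [Equiv.comp_swap_eq_update, heq, update_eq_self, ← heq, update_eq_self]
  have := h i j hij ps
  rw [hps] at this
  linarith

/-- Replacing one displacement replaces the corresponding vertex of the simplex. -/
theorem cons_update_vadd {n : ℕ} (p : P) (vs : Fin n → V) (i : Fin n) (x : V) :
    (Fin.cons p (fun j => update vs i x j +ᵥ p) : Fin (n + 1) → P) =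
      update (Fin.cons p (fun j => vs j +ᵥ p)) i.succ (x +ᵥ p) := by
  rw [← Fin.cons_update]
  congr 1
  ext j
  exact apply_update (fun _ v => v +ᵥ p) vs i x j

variable [Module ℝ V]

/-- A function that changes sign under transpositions and is affine in one argument is affine in
every argument. -/
theorem map_update_lineMap_of_swap_neg {vol : (ι → P) → ℝ} (k : ι)
    (h : ∀ i j, i ≠ j → ∀ ps, vol (ps ∘ swap i j) = -vol ps)
    (haff : ∀ (ps : ι → P) (q : P) (α : ℝ),
      vol (update ps k (AffineMap.lineMap q (ps k) α)) =
        α * vol ps + (1 - α) * vol (update ps k q))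
    (ps : ι → P) (j : ι) (q r : P) (α : ℝ) :
    vol (update ps j (AffineMap.lineMap q r α)) =
      α * vol (update ps j r) + (1 - α) * vol (update ps j q) := by
  have haff' (ps : ι → P) : vol (update ps k (AffineMap.lineMap q r α)) =
      α * vol (update ps k r) + (1 - α) * vol (update ps k q) := by
    simpa using haff (update ps k r) q α
  by_cases hj : k = j
  · exact hj ▸ haff' ps
  have hsw (x : P) : vol (update ps j x) = -vol (update (ps ∘ swap k j) k x) := by
    rw [← h k j hj, update_comp_equiv, comp_assoc, ← Equiv.coe_trans]
    simp
  rw [hsw, hsw, hsw, haff']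
  ring

/-- A function of the vertices of a simplex that is alternating and affine in each vertex, as an
alternating map of the edge vectors at a base vertex `p`. -/
noncomputable def edgeAlternatingMap {n : ℕ} (vol : (Fin (n + 1) → P) → ℝ)
    (h : ∀ i j, i ≠ j → ∀ ps, vol (ps ∘ swap i j) = -vol ps)
    (haff : ∀ (ps : Fin (n + 1) → P) (j : Fin (n + 1)) (q r : P) (α : ℝ),
      vol (update ps j (AffineMap.lineMap q r α)) =
        α * vol (update ps j r) + (1 - α) * vol (update ps j q))
    (p : P) : AlternatingMap ℝ V ℝ (Fin n) :=
  have hsmul (vs : Fin n → V) (i : Fin n) (c : ℝ) (x : V) :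
      vol (Fin.cons p (fun j => update vs i (c • x) j +ᵥ p)) =
        c * vol (Fin.cons p (fun j => update vs i x j +ᵥ p)) := by
    have hzero : vol (update (Fin.cons p (fun j => vs j +ᵥ p)) i.succ p) = 0 :=
      eq_zero_of_swap_neg h (Fin.succ_ne_zero i) (by simp [(Fin.succ_ne_zero i).symm])
    have hline : c • x +ᵥ p = AffineMap.lineMap p (x +ᵥ p) c := by
      simp [AffineMap.lineMap_apply]
    rw [cons_update_vadd, cons_update_vadd, hline, haff, hzero]
    ring
  have hadd (vs : Fin n → V) (i : Fin n) (x y : V) :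
      vol (Fin.cons p (fun j => update vs i (x + y) j +ᵥ p)) =
        vol (Fin.cons p (fun j => update vs i x j +ᵥ p)) +
          vol (Fin.cons p (fun j => update vs i y j +ᵥ p)) := by
    have hline : (x + y) +ᵥ p =
        AffineMap.lineMap ((2 : ℝ) • x +ᵥ p) ((2 : ℝ) • y +ᵥ p) (1 / 2 : ℝ) := by
      rw [AffineMap.lineMap_apply, vadd_vsub_vadd_cancel_right, vadd_vadd]
      congr 1
      module
    rw [cons_update_vadd, hline, haff, ← cons_update_vadd, ← cons_update_vadd, hsmul, hsmul]
    ring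
  { toFun := fun vs => vol (Fin.cons p (fun i => vs i +ᵥ p))
    map_update_add' := fun {inst} vs i x y => by
      cases Subsingleton.elim inst (instDecidableEqFin n)
      exact hadd vs i x y
    map_update_smul' := fun {inst} vs i c x => by
      cases Subsingleton.elim inst (instDecidableEqFin n)
      exact hsmul vs i c x
    map_eq_zero_of_eq' := fun vs i j heq hij =>
      eq_zero_of_swap_neg h ((Fin.succ_injective n).ne hij) (by simp [heq]) }

end AffineVolume


/-- Let `vol` be an affine volume on an `n`-dimensional real affine space.
Then `vol (p, p + v₁, …, p + vₙ)` does not depend on the point `p`, and the resulting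
function `mlt (v₁, …, vₙ) := vol (p, p + v₁, …, p + vₙ)` is multilinear and alternating,
i.e. it is given by an alternating (multilinear) map `(Fin n → V) → ℝ`. -/
theorem statement3 {V P : Type*} [AddCommGroup V] [Module ℝ V] [AddTorsor V P]
    (n : ℕ) (hdim : Module.finrank ℝ V = n)
    (vol : (Fin (n + 1) → P) → ℝ)
    (hvol_ne : ∃ ps : Fin (n + 1) → P, vol ps ≠ 0)
    (hvol_trans : ∀ (v : V) (ps : Fin (n + 1) → P), vol (fun i => v +ᵥ ps i) = vol ps)
    (hvol_perm : ∀ (σ : Equiv.Perm (Fin (n + 1))) (ps : Fin (n + 1) → P),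
      vol (ps ∘ σ) = ((Equiv.Perm.sign σ : ℤ) : ℝ) * vol ps)
    (hvol_aff : ∀ (ps : Fin (n + 1) → P) (q : P) (α : ℝ),
      vol (Function.update ps 0 (AffineMap.lineMap q (ps 0) α)) =
        α * vol ps + (1 - α) * vol (Function.update ps 0 q)) :
    (∀ (p p' : P) (vs : Fin n → V),
        vol (Fin.cons p (fun i => vs i +ᵥ p)) = vol (Fin.cons p' (fun i => vs i +ᵥ p'))) ∧
      ∃ mlt : AlternatingMap ℝ V ℝ (Fin n),
        ∀ (p : P) (vs : Fin n → V), mlt vs = vol (Fin.cons p (fun i => vs i +ᵥ p)) := by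
  have hbase (p p' : P) (vs : Fin n → V) :
      vol (Fin.cons p (fun i => vs i +ᵥ p)) = vol (Fin.cons p' (fun i => vs i +ᵥ p')) := by
    rw [← hvol_trans (p' -ᵥ p)]
    congr 1
    ext i
    refine Fin.cases ?_ (fun j => ?_) i
    · simp
    · simp [vadd_comm (p' -ᵥ p)]
  have hswap (i j : Fin (n + 1)) (hij : i ≠ j) (ps : Fin (n + 1) → P) :
      vol (ps ∘ swap i j) = -vol ps := by
    simp [hvol_perm, Equiv.Perm.sign_swap hij]
  obtain ⟨ps, -⟩ := hvol_ne
  exact ⟨hbase,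
    edgeAlternatingMap vol hswap (map_update_lineMap_of_swap_neg 0 hswap hvol_aff) (ps 0),
    fun p vs => hbase (ps 0) p vs⟩
end

section
/- Let W be a real vector space of dimension 4. Every element x ∈ Λ²W can be written as a sum of two decomposable 2-vectors: there exist a, b, c, d ∈ W with x = a ∧ b + c ∧ d. (Every system of applied forces is reducible to the sum of two forces.) -/
open ExteriorAlgebra

namespace ExteriorAlgebra

variable {R M : Type*} [CommRing R] [AddCommGroup M] [Module R M]

theorem ι_mul_ι_eq_neg (a b : M) : ι R a * ι R b = -(ι R b * ι R a) :=
  eq_neg_of_add_eq_zero_left (ι_add_mul_swap a b)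

/-- Coordinates of a 2-vector with respect to a basis indexed by `Fin 4`. -/
theorem exists_coordinates_of_mem_exteriorPower_two (e : Module.Basis (Fin 4) R M)
    {x : ExteriorAlgebra R M} (hx : x ∈ ⋀[R]^2 M) :
    ∃ p q r s t u : R, x =
      p • (ι R (e 0) * ι R (e 1)) + q • (ι R (e 0) * ι R (e 2)) + r • (ι R (e 0) * ι R (e 3)) +
      s • (ι R (e 1) * ι R (e 2)) + t • (ι R (e 1) * ι R (e 3)) +
      u • (ι R (e 2) * ι R (e 3)) := by
  rw [exteriorPower, pow_two] at hx
  induction hx using Submodule.mul_induction_on' with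
  | mem_mul_mem m hm n hn =>
    obtain ⟨a, rfl⟩ := hm
    obtain ⟨b, rfl⟩ := hn
    refine ⟨e.repr a 0 * e.repr b 1 - e.repr a 1 * e.repr b 0,
      e.repr a 0 * e.repr b 2 - e.repr a 2 * e.repr b 0,
      e.repr a 0 * e.repr b 3 - e.repr a 3 * e.repr b 0,
      e.repr a 1 * e.repr b 2 - e.repr a 2 * e.repr b 1,
      e.repr a 1 * e.repr b 3 - e.repr a 3 * e.repr b 1,
      e.repr a 2 * e.repr b 3 - e.repr a 3 * e.repr b 2, ?_⟩
    conv_lhs => rw [← e.sum_repr a, ← e.sum_repr b]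
    simp only [Fin.sum_univ_four, map_add, map_smul, add_mul, mul_add, smul_mul_assoc,
      mul_smul_comm, ι_sq_zero, ι_mul_ι_eq_neg (e 1) (e 0), ι_mul_ι_eq_neg (e 2) (e 0),
      ι_mul_ι_eq_neg (e 3) (e 0), ι_mul_ι_eq_neg (e 2) (e 1), ι_mul_ι_eq_neg (e 3) (e 1),
      ι_mul_ι_eq_neg (e 3) (e 2)]
    module
  | add x _ y _ ihx ihy =>
    obtain ⟨p, q, r, s, t, u, rfl⟩ := ihx
    obtain ⟨p', q', r', s', t', u', rfl⟩ := ihy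
    exact ⟨p + p', q + q', r + r', s + s', t + t', u + u', by module⟩

/-- Over a field, every 2-vector in the span of the products of three vectors is decomposable. -/
theorem exists_ι_mul_ι_eq_of_three {K V : Type*} [Field K] [AddCommGroup V] [Module K V]
    (e f g : V) (s t u : K) :
    ∃ c d : V, s • (ι K e * ι K f) + t • (ι K e * ι K g) + u • (ι K f * ι K g) =
      ι K c * ι K d := by
  by_cases hs : s = 0
  · refine ⟨t • e + u • f, g, ?_⟩
    simp only [hs, map_add, map_smul, add_mul, smul_mul_assoc]
    module
  · obtain ⟨k, rfl⟩ : ∃ k, u = k * s := ⟨u / s, (div_mul_cancel₀ u hs).symm⟩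
    refine ⟨e - k • g, s • f + t • g, ?_⟩
    simp only [map_add, map_sub, map_smul, sub_mul, mul_add, smul_mul_assoc, mul_smul_comm,
      ι_sq_zero, ι_mul_ι_eq_neg g f, smul_neg]
    module

end ExteriorAlgebra

/-- Let `W` be a real vector space of dimension 4.  Every `x ∈ Λ²W` is the
sum of two decomposable 2-vectors: `x = a ∧ b + c ∧ d` for some `a, b, c, d ∈ W`. -/
theorem statement9 {W : Type*} [AddCommGroup W] [Module ℝ W]
    (hdim : Module.finrank ℝ W = 4)
    (x : ExteriorAlgebra ℝ W) (hx : x ∈ ⋀[ℝ]^2 W) :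
    ∃ a b c d : W, x = ι ℝ a * ι ℝ b + ι ℝ c * ι ℝ d := by
  have : Module.Finite ℝ W := Module.finite_of_finrank_pos (by omega)
  let e := Module.finBasisOfFinrankEq ℝ W hdim
  obtain ⟨p, q, r, s, t, u, rfl⟩ := exists_coordinates_of_mem_exteriorPower_two e hx
  obtain ⟨c, d, hcd⟩ := exists_ι_mul_ι_eq_of_three (e 1) (e 2) (e 3) s t u
  refine ⟨e 0, p • e 1 + q • e 2 + r • e 3, c, d, ?_⟩
  rw [← hcd]
  simp only [map_add, map_smul, mul_add, mul_smul_comm]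
  module
end

section
/- Let V be a real vector space of dimension 3. Every element of Λ²V is decomposable: for every x ∈ Λ²V there exist v, w ∈ V with x = v ∧ w. (Poinsot rule: a linear combination of bivectors is a bivector.) -/
open ExteriorAlgebra

/-- The exterior products of the pairs of basis vectors span the bivectors of a free module of
rank three. -/
lemma exists_bivector_coords {R M : Type*} [CommRing R] [AddCommGroup M] [Module R M]
    (e : Module.Basis (Fin 3) R M) {x : ExteriorAlgebra R M} (hx : x ∈ ⋀[R]^2 M) :
    ∃ a b c : R, x = a • (ι R (e 0) * ι R (e 1)) + b • (ι R (e 0) * ι R (e 2)) +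
      c • (ι R (e 1) * ι R (e 2)) := by
  rw [exteriorPower, pow_two] at hx
  induction hx using Submodule.mul_induction_on' with
  | mem_mul_mem m hm n hn =>
    obtain ⟨v, rfl⟩ := hm
    obtain ⟨w, rfl⟩ := hn
    have swap (i j : Fin 3) : ι R (e i) * ι R (e j) = -(ι R (e j) * ι R (e i)) :=
      eq_neg_of_add_eq_zero_left (ι_add_mul_swap _ _)
    refine ⟨e.repr v 0 * e.repr w 1 - e.repr v 1 * e.repr w 0,
      e.repr v 0 * e.repr w 2 - e.repr v 2 * e.repr w 0,
      e.repr v 1 * e.repr w 2 - e.repr v 2 * e.repr w 1, ?_⟩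
    conv_lhs => rw [← e.sum_repr v, ← e.sum_repr w]
    simp only [Fin.sum_univ_three, map_add, map_smul, add_mul, mul_add, smul_mul_assoc,
      mul_smul_comm, ι_sq_zero, swap 1 0, swap 2 0, swap 2 1]
    module
  | add x _ y _ hx hy =>
    obtain ⟨a, b, c, rfl⟩ := hx
    obtain ⟨a', b', c', rfl⟩ := hy
    exact ⟨a + a', b + b', c + c', by module⟩

/-- Let `V` be a real vector space of dimension 3.  Every element of `Λ²V`
is decomposable: `x = v ∧ w` for some `v, w ∈ V` (Poinsot rule: a linear combination of
bivectors is a bivector). -/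
theorem statement10 {V : Type*} [AddCommGroup V] [Module ℝ V]
    (hdim : Module.finrank ℝ V = 3)
    (x : ExteriorAlgebra ℝ V) (hx : x ∈ ⋀[ℝ]^2 V) :
    ∃ v w : V, x = ι ℝ v * ι ℝ w := by
  have : FiniteDimensional ℝ V := Module.finite_of_finrank_eq_succ hdim
  let e := Module.finBasisOfFinrankEq ℝ V hdim
  obtain ⟨a, b, c, rfl⟩ := exists_bivector_coords e hx
  by_cases ha : a = 0
  · refine ⟨b • e 0 + c • e 1, e 2, ?_⟩
    simp [ha, add_mul]
  · refine ⟨e 0 - (c / a) • e 2, a • e 1 + b • e 2, ?_⟩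
    have swap : ι ℝ (e 2) * ι ℝ (e 1) = -(ι ℝ (e 1) * ι ℝ (e 2)) :=
      eq_neg_of_add_eq_zero_left (ι_add_mul_swap _ _)
    simp only [map_add, map_sub, map_smul, sub_mul, mul_add, smul_mul_assoc, mul_smul_comm,
      ι_sq_zero, swap]
    match_scalars <;> field_simp
end
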